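/- arXiv:math/0511204 — 2 statements merged into one kernel-verified Lean document; each statement's English description precedes it below -/
import Mathlib

section
/- (Theorem 3.7) Assume p > 2, |2a|_p = |b|_p and |2a − b|_p = |a|_p. Then: (i) the basin of attraction of the fixed point 0 is exactly B_{1/|a|_p}(0), i.e. for x ∈ D the iterates fⁿ(x) are all defined and converge to 0 if and only if |x|_p < 1/|a|_p; (ii) the open ball B_{1/|a−b|_p}(x₂) is the maximal Siegel disk of the fixed point x₂ = 1/(a−b): every sphere S_ρ(x₂) with 0 < ρ < 1/|a−b|_p is f-invariant, while the point x₀ = −1/a satisfies |x₀ − x₂|_p = 1/|a−b|_p and f(x₀) = x₂. -/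
open Function Filter

theorem Padic.norm_add_eq_right_of_lt {p : ℕ} [Fact p.Prime] {x y : ℚ_[p]} (h : ‖x‖ < ‖y‖) :
    ‖x + y‖ = ‖y‖ := by
  rw [Padic.add_eq_max_of_ne h.ne, max_eq_right h.le]

theorem Padic.norm_two_eq_one {p : ℕ} [Fact p.Prime] (hp : 2 < p) : ‖(2 : ℚ_[p])‖ = 1 := by
  have h : (2 : ℕ).Coprime p :=
    (Nat.coprime_primes Nat.prime_two Fact.out).2 hp.ne
  exact_mod_cast Padic.norm_natCast_eq_one_iff.2 h.symm

section QuadraticRational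

variable {p : ℕ} [Fact p.Prime] {a b x : ℚ_[p]}

theorem norm_quadraticRational_of_lt (h : ‖a‖ = ‖b‖) (hx : ‖a‖ * ‖x‖ < 1) :
    ‖a * x ^ 2 / (b * x + 1)‖ = ‖a‖ * ‖x‖ ^ 2 := by
  have hden : ‖b * x + 1‖ = 1 := by
    rw [Padic.norm_add_eq_right_of_lt (by simpa [← h] using hx), norm_one]
  simp [hden]

theorem one_le_norm_quadraticRational (h : ‖a‖ = ‖b‖) (hx : 1 ≤ ‖a‖ * ‖x‖)
    (hden : b * x + 1 ≠ 0) : 1 ≤ ‖a‖ * ‖a * x ^ 2 / (b * x + 1)‖ := by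
  have hle : ‖b * x + 1‖ ≤ ‖a‖ * ‖x‖ :=
    (Padic.nonarchimedean _ _).trans (by simp [← h, hx])
  have hpos : 0 < ‖b * x + 1‖ := norm_pos_iff.2 hden
  rw [norm_div, norm_mul, norm_pow, ← mul_div_assoc, le_div_iff₀ hpos]
  nlinarith

/-- The displacement of `x` from the nonzero fixed point is multiplied by
`(a * x + 1) / (b * x + 1)`. -/
theorem quadraticRational_sub_fixedPoint (hab : a - b ≠ 0) (hden : b * x + 1 ≠ 0) :
    a * x ^ 2 / (b * x + 1) - 1 / (a - b) =
      (x - 1 / (a - b)) * ((a * x + 1) / (b * x + 1)) := by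
  rw [div_sub_div _ _ hden hab, sub_div' hab, div_mul_div_comm, mul_comm (a - b)]
  congr 1
  ring

/-- An affine map `x ↦ c * x + 1` has constant norm on a ball on which its variation is smaller
than its value at the centre. -/
theorem norm_mul_add_one_of_norm_sub_lt {c y : ℚ_[p]} (hc : ‖c‖ = ‖a‖) (ha : a ≠ 0)
    (hab : a - b ≠ 0) (hval : ‖c + (a - b)‖ = ‖a‖)
    (hy : ‖y - 1 / (a - b)‖ < 1 / ‖a - b‖) : ‖c * y + 1‖ = ‖a‖ / ‖a - b‖ := by
  have hsplit : c * y + 1 = c * (y - 1 / (a - b)) + (c + (a - b)) / (a - b) := by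
    field_simp
    ring
  have hnorm : ‖(c + (a - b)) / (a - b)‖ = ‖a‖ / ‖a - b‖ := by rw [norm_div, hval]
  rw [hsplit, Padic.norm_add_eq_right_of_lt, hnorm]
  rw [hnorm, norm_mul, hc, div_eq_mul_one_div ‖a‖]
  exact mul_lt_mul_of_pos_left hy (norm_pos_iff.2 ha)

end QuadraticRational

/-- Theorem 3.7: if p > 2, |2a|_p = |b|_p and |2a−b|_p = |a|_p, then
(i) the basin of attraction of the fixed point 0 of f(x) = a·x²/(b·x+1) is
exactly the open ball B_{1/|a|_p}(0), and
(ii) the open ball B_{1/|a−b|_p}(x₂) is the maximal Siegel disk of the fixed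
point x₂ = 1/(a−b): every sphere S_ρ(x₂) with 0 < ρ < 1/|a−b|_p is
f-invariant, while x₀ = −1/a lies on the sphere of radius 1/|a−b|_p about x₂
and is mapped by f directly onto x₂. -/
theorem basin_and_siegel_disk_case_3_7 {p : ℕ} [Fact p.Prime] (hp : 2 < p)
    (a b : ℚ_[p]) (ha : a ≠ 0) (hb : b ≠ 0) (hab : a ≠ b)
    (hnorm1 : ‖2 * a‖ = ‖b‖) (hnorm2 : ‖2 * a - b‖ = ‖a‖)
    (f : ℚ_[p] → ℚ_[p]) (hf : ∀ x, f x = a * x ^ 2 / (b * x + 1))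
    (P : ℚ_[p]) (hP : P = -1 / b)
    (x₂ : ℚ_[p]) (hx₂ : x₂ = 1 / (a - b)) :
    (∀ x : ℚ_[p], x ≠ P →
      (((∀ n : ℕ, f^[n] x ≠ P) ∧ Tendsto (fun n : ℕ => f^[n] x) atTop (nhds 0)) ↔
        ‖x‖ < 1 / ‖a‖)) ∧
    (∀ ρ : ℝ, 0 < ρ → ρ < 1 / ‖a - b‖ →
      ∀ x : ℚ_[p], ‖x - x₂‖ = ρ → x ≠ P ∧ ‖f x - x₂‖ = ρ) ∧
    ‖(-1 / a : ℚ_[p]) - x₂‖ = 1 / ‖a - b‖ ∧ f (-1 / a) = x₂ := by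
  have hnorm : ‖a‖ = ‖b‖ := by
    rw [← hnorm1, norm_mul, Padic.norm_two_eq_one hp, one_mul]
  have ha' : 0 < ‖a‖ := norm_pos_iff.2 ha
  have hd : a - b ≠ 0 := sub_ne_zero.2 hab
  have hd' : 0 < ‖a - b‖ := norm_pos_iff.2 hd
  have hpole : ∀ x, x ≠ P ↔ b * x + 1 ≠ 0 := by
    intro x
    rw [hP, not_iff_not, eq_div_iff hb, mul_comm, eq_neg_iff_add_eq_zero]
  subst hx₂
  refine ⟨fun x _ => ⟨?_, ?_⟩, ?_, ?_, ?_⟩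
  · rintro ⟨hdef, hlim⟩
    by_contra! hx
    have hfar : ∀ n, 1 ≤ ‖a‖ * ‖f^[n] x‖ := by
      intro n
      induction n with
      | zero => exact (div_le_iff₀' ha').1 hx
      | succ n ih =>
        rw [iterate_succ_apply', hf]
        exact one_le_norm_quadraticRational hnorm ih ((hpole _).1 (hdef n))
    have hlim' := hlim.norm.const_mul ‖a‖
    rw [norm_zero, mul_zero] at hlim'
    exact absurd (ge_of_tendsto' hlim' hfar) (by norm_num)
  · intro hx
    set t := ‖a‖ * ‖x‖ with ht
    have ht0 : 0 ≤ t := by positivity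
    have ht1 : t < 1 := by rwa [lt_div_iff₀' ha'] at hx
    have hbound : ∀ n, ‖a‖ * ‖f^[n] x‖ ≤ t ^ (n + 1) := by
      intro n
      induction n with
      | zero => simp [ht]
      | succ n ih =>
        have hlt : ‖a‖ * ‖f^[n] x‖ ≤ t :=
          ih.trans (pow_le_of_le_one ht0 ht1.le n.succ_ne_zero)
        rw [iterate_succ_apply', hf,
          norm_quadraticRational_of_lt hnorm (hlt.trans_lt ht1)]
        calc ‖a‖ * (‖a‖ * ‖f^[n] x‖ ^ 2)
            = (‖a‖ * ‖f^[n] x‖) * (‖a‖ * ‖f^[n] x‖) := by ring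
          _ ≤ t ^ (n + 1) * t := by gcongr
          _ = t ^ (n + 1 + 1) := (pow_succ _ _).symm
    refine ⟨fun n hn => ?_, ?_⟩
    · have hlt := (hbound n).trans_lt (pow_lt_one₀ ht0 ht1 n.succ_ne_zero)
      rw [hn, hP, norm_div, norm_neg, norm_one, ← hnorm, mul_one_div_cancel ha'.ne'] at hlt
      exact lt_irrefl _ hlt
    · have hpow : Tendsto (fun n : ℕ => t ^ (n + 1) / ‖a‖) atTop (nhds 0) := by
        simpa using ((tendsto_pow_atTop_nhds_zero_of_lt_one ht0 ht1).comp
          (tendsto_add_atTop_nat 1)).div_const ‖a‖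
      exact squeeze_zero_norm (fun n => (le_div_iff₀' ha').2 (hbound n)) hpow
  · intro ρ _ hρ x hx
    rw [← hx] at hρ
    have hden : ‖b * x + 1‖ = ‖a‖ / ‖a - b‖ :=
      norm_mul_add_one_of_norm_sub_lt hnorm.symm ha hd (by simp) hρ
    have hnum : ‖a * x + 1‖ = ‖a‖ / ‖a - b‖ :=
      norm_mul_add_one_of_norm_sub_lt rfl ha hd (by rw [← hnorm2]; congr 1; ring) hρ
    have hpos : 0 < ‖a‖ / ‖a - b‖ := div_pos ha' hd'
    have hne : b * x + 1 ≠ 0 := norm_pos_iff.1 (hden ▸ hpos)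
    refine ⟨(hpole x).2 hne, ?_⟩
    rw [hf, quadraticRational_sub_fixedPoint hd hne, norm_mul, norm_div, hnum, hden,
      div_self hpos.ne', mul_one, hx]
  · have hdist : -1 / a - 1 / (a - b) = -((2 * a - b) / (a * (a - b))) := by
      field_simp
      ring
    rw [hdist, norm_neg, norm_div, norm_mul, hnorm2]
    field_simp
  · have hden : b * (-1 / a) + 1 = (a - b) / a := by
      field_simp
      ring
    rw [hf, hden]
    field_simp
end

section
/- (Theorem 3.8) Assume p = 2 and |2a|_p > |b|_p. Then both fixed points are attracting and their basins are open balls of radius 1/|a|_p: for x ∈ D, all iterates fⁿ(x) are defined and fⁿ(x) → 0 if and only if |x|_p < 1/|a|_p; and all iterates fⁿ(x) are defined and fⁿ(x) → x₂ if and only if |x − x₂|_p < 1/|a|_p, where x₂ = 1/(a−b). -/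
open Function Filter

/-- If `g` contracts the open ball of radius `R` about `z` at rate `max k (dist y z / R)`, and maps
the points of `{P}ᶜ` outside this ball to points outside it, then the ball is the basin of
attraction of `z` among the orbits avoiding `P`. -/
theorem basin_iff_dist_lt {X : Type*} [PseudoMetricSpace X] (g : X → X) (P z : X) {R k : ℝ}
    (hR : 0 < R) (hk₀ : 0 ≤ k) (hk : k < 1) (hP : R ≤ dist P z)
    (hnear : ∀ y, dist y z < R → dist (g y) z ≤ max k (dist y z / R) * dist y z)
    (hfar : ∀ y, y ≠ P → R ≤ dist y z → R ≤ dist (g y) z) (x : X) :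
    ((∀ n : ℕ, g^[n] x ≠ P) ∧ Tendsto (fun n : ℕ => g^[n] x) atTop (nhds z)) ↔
      dist x z < R := by
  constructor
  · rintro ⟨hdef, hlim⟩
    by_contra! hx
    have hout : ∀ n : ℕ, R ≤ dist (g^[n] x) z := by
      intro n
      induction n with
      | zero => exact hx
      | succ n ih =>
        rw [iterate_succ_apply']
        exact hfar _ (hdef n) ih
    obtain ⟨n, hn⟩ := (hlim.eventually (Metric.ball_mem_nhds z hR)).exists
    exact (hout n).not_gt hn
  · intro hx
    set q := max k (dist x z / R)
    have hq₀ : 0 ≤ q := hk₀.trans (le_max_left _ _)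
    have hq : q < 1 := max_lt hk ((div_lt_one hR).2 hx)
    have hbound : ∀ n : ℕ, dist (g^[n] x) z ≤ q ^ n * dist x z := by
      intro n
      induction n with
      | zero => simp
      | succ n ih =>
        have hle : dist (g^[n] x) z ≤ dist x z :=
          ih.trans (mul_le_of_le_one_left dist_nonneg (pow_le_one₀ hq₀ hq.le))
        rw [iterate_succ_apply']
        calc dist (g (g^[n] x)) z
            ≤ max k (dist (g^[n] x) z / R) * dist (g^[n] x) z := hnear _ (hle.trans_lt hx)
          _ ≤ q * (q ^ n * dist x z) := by
            gcongr
            exact max_le_max le_rfl (by gcongr)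
          _ = q ^ (n + 1) * dist x z := by ring
    refine ⟨fun n hn => ?_, ?_⟩
    · have h := hbound n
      rw [hn] at h
      have := mul_le_of_le_one_left (dist_nonneg (x := x) (y := z)) (pow_le_one₀ hq₀ hq.le (n := n))
      linarith
    · rw [tendsto_iff_dist_tendsto_zero]
      refine squeeze_zero (fun _ => dist_nonneg) hbound ?_
      simpa using (tendsto_pow_atTop_nhds_zero_of_lt_one hq₀ hq).mul_const (dist x z)

theorem mul_sq_div_sub_fixedPoint {K : Type*} [Field K] {a b y : K} (hab : a ≠ b)
    (hy : b * y + 1 ≠ 0) :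
    a * y ^ 2 / (b * y + 1) - 1 / (a - b) = (a * y + 1) / (b * y + 1) * (y - 1 / (a - b)) := by
  have hsub := sub_ne_zero.2 hab
  generalize hd : b * y + 1 = d at hy ⊢
  field_simp
  rw [← hd]
  ring

section Ultrametric

variable {K : Type*} [NormedField K] [IsUltrametricDist K] {a b : K}

theorem norm_mul_add_one_eq_one {y : K} (hba : ‖b‖ < ‖a‖) (hy : ‖a‖ * ‖y‖ ≤ 1) :
    ‖b * y + 1‖ = 1 := by
  have hlt : ‖b * y‖ < ‖(1 : K)‖ := by
    rw [norm_mul, norm_one]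
    rcases (norm_nonneg y).eq_or_lt with h | h
    · simp [← h]
    · exact (mul_lt_mul_of_pos_right hba h).trans_le hy
  rw [IsUltrametricDist.norm_add_eq_max_of_norm_ne_norm hlt.ne, max_eq_right hlt.le, norm_one]

theorem norm_mul_add_one_le {y : K} {t : ℝ} (hba : ‖b‖ ≤ ‖a‖) (ht : 1 ≤ ‖a‖ * t) (hy : ‖y‖ ≤ t) :
    ‖b * y + 1‖ ≤ ‖a‖ * t := by
  refine (IsUltrametricDist.norm_add_le_max _ _).trans (max_le ?_ (by rwa [norm_one]))
  rw [norm_mul]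
  gcongr

theorem norm_sub_eq_left {u v : K} (h : ‖v‖ < ‖u‖) : ‖u - v‖ = ‖u‖ := by
  rw [sub_eq_add_neg, IsUltrametricDist.norm_add_eq_max_of_norm_ne_norm (by simpa using h.ne'),
    norm_neg, max_eq_left h.le]

theorem mul_sq_div_basin_zero (ha : a ≠ 0) (hb : b ≠ 0) (hba : ‖b‖ < ‖a‖) (f : K → K)
    (hf : ∀ x, f x = a * x ^ 2 / (b * x + 1)) (x : K) :
    ((∀ n : ℕ, f^[n] x ≠ -1 / b) ∧ Tendsto (fun n : ℕ => f^[n] x) atTop (nhds 0)) ↔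
      ‖x‖ < 1 / ‖a‖ := by
  have hA : 0 < ‖a‖ := norm_pos_iff.2 ha
  rw [← dist_zero_right]
  refine basin_iff_dist_lt f _ _ (k := 0) (by positivity) le_rfl one_pos ?_ ?_ ?_ x
  · rw [dist_zero_right, norm_div, norm_neg, norm_one]
    have := norm_pos_iff.2 hb
    gcongr
  · intro y hy
    rw [dist_zero_right] at hy ⊢
    rw [lt_div_iff₀' hA] at hy
    rw [dist_zero_right, hf, norm_div, norm_mul_add_one_eq_one hba hy.le, norm_mul, norm_pow]
    refine le_trans (le_of_eq ?_)
      (mul_le_mul_of_nonneg_right (le_max_right _ _) (norm_nonneg y))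
    field_simp
  · intro y hyP hy
    rw [dist_zero_right] at hy ⊢
    refine hy.trans ?_
    rw [div_le_iff₀' hA] at hy
    have hne : b * y + 1 ≠ 0 := fun h => hyP (by rw [eq_div_iff hb]; linear_combination h)
    rw [hf, norm_div, norm_mul, norm_pow, le_div_iff₀ (norm_pos_iff.2 hne)]
    calc ‖y‖ * ‖b * y + 1‖ ≤ ‖y‖ * (‖a‖ * ‖y‖) := by
          gcongr
          exact norm_mul_add_one_le hba.le hy le_rfl
      _ = ‖a‖ * ‖y‖ ^ 2 := by ring

theorem mul_sq_div_basin_fixedPoint (hb : b ≠ 0) (h2 : ‖(2 : K)‖ < 1) (hba : ‖b‖ < ‖2 * a‖)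
    (f : K → K) (hf : ∀ x, f x = a * x ^ 2 / (b * x + 1)) (x : K) :
    ((∀ n : ℕ, f^[n] x ≠ -1 / b) ∧
      Tendsto (fun n : ℕ => f^[n] x) atTop (nhds (1 / (a - b)))) ↔
      ‖x - 1 / (a - b)‖ < 1 / ‖a‖ := by
  have hba' : ‖b‖ < ‖a‖ := by
    rw [norm_mul] at hba
    exact hba.trans_le (mul_le_of_le_one_left (norm_nonneg a) h2.le)
  have hA : 0 < ‖a‖ := (norm_nonneg b).trans_lt hba'
  have hab : a ≠ b := fun h => hba'.ne (by rw [h])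
  have hsub : a - b ≠ 0 := sub_ne_zero.2 hab
  have hsubnorm : ‖a - b‖ = ‖a‖ := norm_sub_eq_left hba'
  set z := 1 / (a - b) with hz
  have hznorm : ‖z‖ = 1 / ‖a‖ := by rw [hz, norm_div, norm_one, hsubnorm]
  have hmult : ‖a * z + 1‖ = ‖(2 : K)‖ := by
    have : a * z + 1 = (2 * a - b) / (a - b) := by
      rw [hz]
      field_simp
      ring
    rw [this, norm_div, hsubnorm, norm_sub_eq_left hba, norm_mul, mul_div_cancel_right₀ _ hA.ne']
  have hsplit (y : K) : a * y + 1 = a * (y - z) + (a * z + 1) := by ring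
  rw [← dist_eq_norm]
  refine basin_iff_dist_lt f _ _ (k := ‖(2 : K)‖) (by positivity) (norm_nonneg _) h2 ?_ ?_ ?_ x
  · have hB := norm_pos_iff.2 hb
    have hP : ‖z‖ < ‖-1 / b‖ := by
      rw [hznorm, norm_div, norm_neg, norm_one]
      gcongr
    rw [dist_eq_norm, norm_sub_eq_left hP, ← hznorm]
    exact hP.le
  · intro y hy
    rw [dist_eq_norm] at hy ⊢
    have hyle : ‖a‖ * ‖y‖ ≤ 1 := by
      rw [← le_div_iff₀' hA, ← sub_add_cancel y z]
      exact (IsUltrametricDist.norm_add_le_max _ _).trans (max_le hy.le hznorm.le)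
    have hone := norm_mul_add_one_eq_one hba' hyle
    have hne : b * y + 1 ≠ 0 := fun h => by simp [h] at hone
    rw [dist_eq_norm, hf, mul_sq_div_sub_fixedPoint hab hne, norm_mul, norm_div, hone, div_one]
    gcongr
    rw [hsplit, max_comm]
    refine (IsUltrametricDist.norm_add_le_max _ _).trans (max_le_max (le_of_eq ?_) hmult.le)
    rw [norm_mul]
    field_simp
  · intro y hyP hy
    rw [dist_eq_norm] at hy ⊢
    have hyle : ‖y‖ ≤ ‖y - z‖ := by
      conv_lhs => rw [← sub_add_cancel y z]
      exact (IsUltrametricDist.norm_add_le_max _ _).trans (max_le le_rfl (hznorm.trans_le hy))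
    have hne : b * y + 1 ≠ 0 := fun h => hyP (by rw [eq_div_iff hb]; linear_combination h)
    refine hy.trans ?_
    rw [div_le_iff₀' hA] at hy
    have hlt : ‖a * z + 1‖ < ‖a * (y - z)‖ := by
      rw [hmult, norm_mul]
      exact h2.trans_le hy
    rw [hf, mul_sq_div_sub_fixedPoint hab hne, norm_mul, norm_div, hsplit,
      IsUltrametricDist.norm_add_eq_max_of_norm_ne_norm hlt.ne', max_eq_left hlt.le, norm_mul]
    refine le_mul_of_one_le_left (norm_nonneg _) ((one_le_div (norm_pos_iff.2 hne)).2 ?_)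
    exact norm_mul_add_one_le hba'.le hy hyle

end Ultrametric

/-- Theorem 3.8: if p = 2 and |2a|_p > |b|_p, then both fixed points x₁ = 0 and
x₂ = 1/(a−b) of f(x) = a·x²/(b·x+1) are attracting and their basins of
attraction are exactly the open balls of radius 1/|a|_p about them. -/
theorem both_attracting_case_p_eq_two {p : ℕ} [Fact p.Prime] (hp : p = 2)
    (a b : ℚ_[p]) (ha : a ≠ 0) (hb : b ≠ 0) (hab : a ≠ b)
    (hnorm : ‖b‖ < ‖2 * a‖)
    (f : ℚ_[p] → ℚ_[p]) (hf : ∀ x, f x = a * x ^ 2 / (b * x + 1))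
    (P : ℚ_[p]) (hP : P = -1 / b)
    (x₂ : ℚ_[p]) (hx₂ : x₂ = 1 / (a - b))
    (x : ℚ_[p]) (hx : x ≠ P) :
    (((∀ n : ℕ, f^[n] x ≠ P) ∧ Tendsto (fun n : ℕ => f^[n] x) atTop (nhds 0)) ↔
      ‖x‖ < 1 / ‖a‖) ∧
    (((∀ n : ℕ, f^[n] x ≠ P) ∧ Tendsto (fun n : ℕ => f^[n] x) atTop (nhds x₂)) ↔
      ‖x - x₂‖ < 1 / ‖a‖) := by
  have h2 : ‖(2 : ℚ_[p])‖ < 1 := by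
    subst hp
    exact_mod_cast Padic.norm_p_lt_one (p := 2)
  have hba : ‖b‖ < ‖a‖ := by
    rw [norm_mul] at hnorm
    exact hnorm.trans_le (mul_le_of_le_one_left (norm_nonneg a) h2.le)
  subst hP hx₂
  exact ⟨mul_sq_div_basin_zero ha hb hba f hf x,
    mul_sq_div_basin_fixedPoint hb h2 hnorm f hf x⟩
end
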